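/- For an integer M ≥ 1 and real constants a_m ≥ 0, b_m ≥ 0, c_m > 0 (m = 1, …, M), the function x ↦ log(1 + Σ_{m=1}^{M} a_m·x/(b_m·x + c_m)) is concave on [0, ∞). -/

import Mathlib

theorem mul_div_mul_add_le_tangent {a b c x t : ℝ} (ha : 0 ≤ a) (hb : 0 ≤ b) (hc : 0 < c)
    (hx : 0 ≤ x) (ht : 0 ≤ t) :
    a * x / (b * x + c) ≤ a * t / (b * t + c) + a * c / (b * t + c) ^ 2 * (x - t) := by
  have hxc : 0 < b * x + c := by positivity
  have htc : 0 < b * t + c := by positivity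
  have gap : a * t / (b * t + c) + a * c / (b * t + c) ^ 2 * (x - t) - a * x / (b * x + c) =
      a * b * c * (x - t) ^ 2 / ((b * t + c) ^ 2 * (b * x + c)) := by
    field_simp
    ring
  have : 0 ≤ a * b * c * (x - t) ^ 2 / ((b * t + c) ^ 2 * (b * x + c)) := by positivity
  linarith

theorem concaveOn_mul_div_mul_add {a b c : ℝ} (ha : 0 ≤ a) (hb : 0 ≤ b) (hc : 0 < c) :
    ConcaveOn ℝ (Set.Ici (0 : ℝ)) (fun x => a * x / (b * x + c)) := by
  refine ⟨convex_Ici 0, fun x hx y hy s r hs hr hsr => ?_⟩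
  rw [Set.mem_Ici] at hx hy
  simp only [smul_eq_mul]
  have ht : 0 ≤ s * x + r * y := by positivity
  have hx' := mul_le_mul_of_nonneg_left (mul_div_mul_add_le_tangent ha hb hc hx ht) hs
  have hy' := mul_le_mul_of_nonneg_left (mul_div_mul_add_le_tangent ha hb hc hy ht) hr
  obtain rfl : r = 1 - s := by linarith
  linear_combination hx' + hy'

theorem ConcaveOn.log {E : Type*} [AddCommMonoid E] [Module ℝ E] {s : Set E} {f : E → ℝ}
    (hf : ConcaveOn ℝ s f) (hpos : ∀ x ∈ s, 0 < f x) :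
    ConcaveOn ℝ s (fun x => Real.log (f x)) := by
  refine ⟨hf.1, fun x hx y hy p q hp hq hpq => ?_⟩
  have hlog := strictConcaveOn_log_Ioi.concaveOn
  have hmem : p • f x + q • f y ∈ Set.Ioi (0 : ℝ) :=
    hlog.1 (hpos x hx) (hpos y hy) hp hq hpq
  exact (hlog.2 (hpos x hx) (hpos y hy) hp hq hpq).trans
    (Real.log_le_log hmem (hf.2 hx hy hp hq hpq))

/-- **Concavity of the achievable-rate log term.**
For an integer `M ≥ 1` and real constants `a_m ≥ 0`, `b_m ≥ 0`, `c_m > 0`,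
the function `x ↦ log(1 + Σ_m a_m·x/(b_m·x + c_m))` is concave on `[0, ∞)`. -/
theorem rate_log_concave
    (M : ℕ) (hM : 1 ≤ M) (a b c : Fin M → ℝ)
    (ha : ∀ m, 0 ≤ a m) (hb : ∀ m, 0 ≤ b m) (hc : ∀ m, 0 < c m) :
    ConcaveOn ℝ (Set.Ici (0 : ℝ))
      (fun x => Real.log (1 + ∑ m : Fin M, a m * x / (b m * x + c m))) := by
  refine ConcaveOn.log ?_ fun x hx => ?_
  · refine (concaveOn_const 1 (convex_Ici 0)).add
      ⟨convex_Ici 0, fun x hx y hy s r hs hr hsr => ?_⟩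
    simp only [Finset.smul_sum, ← Finset.sum_add_distrib]
    exact Finset.sum_le_sum fun m _ =>
      (concaveOn_mul_div_mul_add (ha m) (hb m) (hc m)).2 hx hy hs hr hsr
  · rw [Set.mem_Ici] at hx
    have : 0 ≤ ∑ m : Fin M, a m * x / (b m * x + c m) := Finset.sum_nonneg fun m _ =>
      div_nonneg (mul_nonneg (ha m) hx) (add_nonneg (mul_nonneg (hb m) hx) (hc m).le)
    positivity
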